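/- Let a > 0. There is no C² function h : (0,1) → ℝ with e^{-a} ≤ h(r) ≤ 1 for all r ∈ (0,1), satisfying h''(r) + h'(r)/r − h(r)/r² = 0 on (0,1), and satisfying either (h'(r) > 0 for all r, lim_{r→0⁺} h(r) = e^{-a}, lim_{r→1⁻} h(r) = 1) or (h'(r) < 0 for all r, lim_{r→0⁺} h(r) = 1, lim_{r→1⁻} h(r) = e^{-a}). -/

import Mathlib

open Real Set Filter Topology

/-- Every solution of the radial Euler equation of harmonic maps on the unit interval has the form
`A * r + B / r`. -/
theorem exists_eq_mul_add_div_of_euler {h : ℝ → ℝ} (hc : ContDiffOn ℝ 2 h (Ioo 0 1))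
    (hode : ∀ r ∈ Ioo (0:ℝ) 1, deriv (deriv h) r + deriv h r / r - h r / r ^ 2 = 0) :
    ∃ A B : ℝ, ∀ r ∈ Ioo (0:ℝ) 1, h r = A * r + B / r := by
  have hd : ∀ r ∈ Ioo (0:ℝ) 1, HasDerivAt h (deriv h r) r := fun r hr =>
    ((hc.differentiableOn two_ne_zero).differentiableAt (isOpen_Ioo.mem_nhds hr)).hasDerivAt
  have hdd : ∀ r ∈ Ioo (0:ℝ) 1, HasDerivAt (deriv h) (deriv (deriv h) r) r := fun r hr =>
    (((hc.deriv_of_isOpen (m := 1) isOpen_Ioo (by norm_num)).differentiableOn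
      one_ne_zero).differentiableAt (isOpen_Ioo.mem_nhds hr)).hasDerivAt
  have hderiv : ∀ r ∈ Ioo (0:ℝ) 1, HasDerivAt (fun x => deriv h x + h x / x) 0 r := by
    intro r hr
    have hr0 : r ≠ 0 := hr.1.ne'
    refine ((hdd r hr).add ((hd r hr).div (hasDerivAt_id r) hr0)).congr_deriv ?_
    rw [← hode r hr]
    simp only [id]
    field_simp
    ring
  obtain ⟨c, hcst⟩ := isOpen_Ioo.exists_is_const_of_deriv_eq_zero isPreconnected_Ioo
    (fun r hr => (hderiv r hr).differentiableAt.differentiableWithinAt)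
    (fun r hr => (hderiv r hr).deriv)
  have hderiv_sq : ∀ r ∈ Ioo (0:ℝ) 1, HasDerivAt (fun x => x * h x - c / 2 * x ^ 2) 0 r := by
    intro r hr
    have hr0 : r ≠ 0 := hr.1.ne'
    refine (((hasDerivAt_id r).mul (hd r hr)).sub
      ((hasDerivAt_pow 2 r).const_mul (c / 2))).congr_deriv ?_
    have := hcst r hr
    simp only [id]
    field_simp at this
    push_cast
    linarith
  obtain ⟨B, hB⟩ := isOpen_Ioo.exists_is_const_of_deriv_eq_zero isPreconnected_Ioo
    (fun r hr => (hderiv_sq r hr).differentiableAt.differentiableWithinAt)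
    (fun r hr => (hderiv_sq r hr).deriv)
  refine ⟨c / 2, B, fun r hr => ?_⟩
  have hr0 : r ≠ 0 := hr.1.ne'
  rw [← hB r hr]
  field_simp
  ring

/-- If `A * r + B / r` has a finite limit as `r → 0⁺`, then this limit is zero. -/
theorem eq_zero_of_tendsto_mul_add_div {h : ℝ → ℝ} {A B L : ℝ}
    (hAB : ∀ r ∈ Ioo (0:ℝ) 1, h r = A * r + B / r)
    (hL : Tendsto h (𝓝[>] (0:ℝ)) (𝓝 L)) : L = 0 := by
  have hmem : Ioo (0:ℝ) 1 ∈ 𝓝[>] (0:ℝ) := Ioo_mem_nhdsGT one_pos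
  have hid : Tendsto (fun r : ℝ => r) (𝓝[>] (0:ℝ)) (𝓝 0) := nhdsWithin_le_nhds
  have hB : B = 0 := by
    have hlim : Tendsto (fun r => r * h r - A * (r * r)) (𝓝[>] (0:ℝ)) (𝓝 0) := by
      simpa using (hid.mul hL).sub ((hid.mul hid).const_mul A)
    refine tendsto_nhds_unique (tendsto_const_nhds.congr' ?_) hlim
    filter_upwards [hmem] with r hr
    have hr0 : r ≠ 0 := hr.1.ne'
    rw [hAB r hr]
    field_simp
    ring
  have hlim : Tendsto (fun r => A * r) (𝓝[>] (0:ℝ)) (𝓝 0) := by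
    simpa using hid.const_mul A
  refine tendsto_nhds_unique hL (hlim.congr' ?_)
  filter_upwards [hmem] with r hr
  simp [hAB r hr, hB]

theorem stmt_6 (a : ℝ) (ha : 0 < a) :
    ¬ ∃ h : ℝ → ℝ,
      ContDiffOn ℝ 2 h (Ioo 0 1) ∧
      (∀ r ∈ Ioo (0:ℝ) 1, Real.exp (-a) ≤ h r ∧ h r ≤ 1) ∧
      (∀ r ∈ Ioo (0:ℝ) 1,
        deriv (deriv h) r + deriv h r / r - h r / r ^ 2 = 0) ∧
      (((∀ r ∈ Ioo (0:ℝ) 1, 0 < deriv h r) ∧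
          Tendsto h (𝓝[>] (0:ℝ)) (𝓝 (Real.exp (-a))) ∧
          Tendsto h (𝓝[<] (1:ℝ)) (𝓝 1)) ∨
        ((∀ r ∈ Ioo (0:ℝ) 1, deriv h r < 0) ∧
          Tendsto h (𝓝[>] (0:ℝ)) (𝓝 1) ∧
          Tendsto h (𝓝[<] (1:ℝ)) (𝓝 (Real.exp (-a))))) := by
  rintro ⟨h, hc, -, hode, hlim⟩
  obtain ⟨A, B, hAB⟩ := exists_eq_mul_add_div_of_euler hc hode
  rcases hlim with ⟨-, h0, -⟩ | ⟨-, h0, -⟩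
  · exact (Real.exp_pos (-a)).ne' (eq_zero_of_tendsto_mul_add_div hAB h0)
  · exact one_ne_zero (eq_zero_of_tendsto_mul_add_div hAB h0)
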